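/- arXiv:2005.01760 — 5 statements merged into one kernel-verified Lean document; each statement's English description precedes it below -/
import Mathlib

section
/- Let 𝒜 be a unital *-subalgebra of the n'×n' complex matrices, let M := span{ B ⊗ A : B an n×n complex matrix, A ∈ 𝒜 } inside the (n·n')×(n·n') complex matrices, and let N := { B ⊗ 1_{n'} : B an n×n complex matrix }. If ε : M → N is a conditional expectation, then for every A ∈ 𝒜 the element ε(1_n ⊗ A) is a complex scalar multiple of the identity matrix 1_n ⊗ 1_{n'}. -/
open Matrix Kronecker ComplexOrder

/-- The algebra `M = span{ B ⊗ A : B an n×n matrix, A ∈ 𝒜 }` inside the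
`(n·n')×(n·n')` complex matrices (indexed by `Fin n × Fin n'`). -/
noncomputable def kronSpan {n' : ℕ} (n : ℕ)
    (𝒜 : StarSubalgebra ℂ (Matrix (Fin n') (Fin n') ℂ)) :
    Submodule ℂ (Matrix (Fin n × Fin n') (Fin n × Fin n') ℂ) :=
  Submodule.span ℂ {X | ∃ (B : Matrix (Fin n) (Fin n) ℂ) (A : Matrix (Fin n') (Fin n') ℂ),
    A ∈ 𝒜 ∧ X = B ⊗ₖ A}

/-- The subalgebra `N = { B ⊗ 1 : B an n×n matrix }`. -/
def kronN (n n' : ℕ) : Set (Matrix (Fin n × Fin n') (Fin n × Fin n') ℂ) :=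
  {X | ∃ B : Matrix (Fin n) (Fin n) ℂ, X = B ⊗ₖ (1 : Matrix (Fin n') (Fin n') ℂ)}

/-- **For a conditional expectation `ε` from `M = Mₙ(ℂ) ⊗ 𝒜` onto `N = Mₙ(ℂ) ⊗ 1`, the
element `ε(1ₙ ⊗ A)` is a complex scalar multiple of the identity `1ₙ ⊗ 1ₙ'` for every
`A ∈ 𝒜`.** -/
theorem stmt4 {n n' : ℕ}
    (𝒜 : StarSubalgebra ℂ (Matrix (Fin n') (Fin n') ℂ))
    (ε : (kronSpan n 𝒜) →ₗ[ℂ] Matrix (Fin n × Fin n') (Fin n × Fin n') ℂ)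
    -- ε maps M into N
    (hrange : ∀ A : (kronSpan n 𝒜), ε A ∈ kronN n n')
    -- ε is positive
    (hpos : ∀ A : (kronSpan n 𝒜),
      (A : Matrix (Fin n × Fin n') (Fin n × Fin n') ℂ).PosSemidef → (ε A).PosSemidef)
    -- ε is unital
    (hunit : ∀ h1 : (1 : Matrix (Fin n × Fin n') (Fin n × Fin n') ℂ) ∈ kronSpan n 𝒜,
      ε ⟨1, h1⟩ = 1)
    -- bimodule property over N
    (hbimod : ∀ (A : (kronSpan n 𝒜)) (B₁ B₂ : Matrix (Fin n × Fin n') (Fin n × Fin n') ℂ),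
      B₁ ∈ kronN n n' → B₂ ∈ kronN n n' →
      ∀ hm : B₁ * (A : Matrix (Fin n × Fin n') (Fin n × Fin n') ℂ) * B₂ ∈ kronSpan n 𝒜,
        ε ⟨B₁ * (A : Matrix (Fin n × Fin n') (Fin n × Fin n') ℂ) * B₂, hm⟩ = B₁ * ε A * B₂) :
    ∀ A ∈ 𝒜, ∀ hm : (1 : Matrix (Fin n) (Fin n) ℂ) ⊗ₖ A ∈ kronSpan n 𝒜,
      ∃ c : ℂ, ε ⟨(1 : Matrix (Fin n) (Fin n) ℂ) ⊗ₖ A, hm⟩ =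
        c • ((1 : Matrix (Fin n) (Fin n) ℂ) ⊗ₖ (1 : Matrix (Fin n') (Fin n') ℂ)) := by
  intro A hA hm
  obtain ⟨C, hC⟩ := hrange ⟨(1 : Matrix (Fin n) (Fin n) ℂ) ⊗ₖ A, hm⟩
  rw [hC]
  have key : ∀ B : Matrix (Fin n) (Fin n) ℂ,
      (B * C) ⊗ₖ (1 : Matrix (Fin n') (Fin n') ℂ) = (C * B) ⊗ₖ (1 : Matrix (Fin n') (Fin n') ℂ) := by
    intro B
    have hBA : B ⊗ₖ A ∈ kronSpan n 𝒜 := Submodule.subset_span ⟨B, A, hA, rfl⟩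
    have e1 : (B ⊗ₖ (1 : Matrix (Fin n') (Fin n') ℂ)) * ((1 : Matrix (Fin n) (Fin n) ℂ) ⊗ₖ A) *
        ((1 : Matrix (Fin n) (Fin n) ℂ) ⊗ₖ (1 : Matrix (Fin n') (Fin n') ℂ)) = B ⊗ₖ A := by
      simp only [← Matrix.mul_kronecker_mul, Matrix.one_mul, Matrix.mul_one]
    have e2 : ((1 : Matrix (Fin n) (Fin n) ℂ) ⊗ₖ (1 : Matrix (Fin n') (Fin n') ℂ)) *
        ((1 : Matrix (Fin n) (Fin n) ℂ) ⊗ₖ A) *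
        (B ⊗ₖ (1 : Matrix (Fin n') (Fin n') ℂ)) = B ⊗ₖ A := by
      simp only [← Matrix.mul_kronecker_mul, Matrix.one_mul, Matrix.mul_one]
    have h1 := hbimod ⟨_, hm⟩ (B ⊗ₖ 1) (1 ⊗ₖ 1) ⟨B, rfl⟩ ⟨1, rfl⟩ (by rw [e1]; exact hBA)
    have h2 := hbimod ⟨_, hm⟩ (1 ⊗ₖ 1) (B ⊗ₖ 1) ⟨1, rfl⟩ ⟨B, rfl⟩ (by rw [e2]; exact hBA)
    simp only [e1] at h1
    simp only [e2] at h2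
    rw [h1, hC] at h2
    simpa only [← Matrix.mul_kronecker_mul, Matrix.one_mul, Matrix.mul_one] using h2
  rcases isEmpty_or_nonempty (Fin n') with he | ⟨⟨k⟩⟩
  · exact ⟨0, Subsingleton.elim _ _⟩
  · have hcomm : ∀ i j : Fin n, Commute (Matrix.single i j (1 : ℂ)) C := by
      intro i j
      ext a b
      have := congrFun (congrFun (key (Matrix.single i j 1)) (a, k)) (b, k)
      simpa only [Matrix.kroneckerMap_apply, Matrix.one_apply_eq, mul_one] using this
    obtain ⟨c, hc⟩ := Matrix.mem_range_scalar_iff_commute_single'.mpr hcomm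
    refine ⟨c, ?_⟩
    rw [← hc, ← Matrix.smul_kronecker, Matrix.scalar_apply, Matrix.smul_one_eq_diagonal]
end

section
/- (Entropic certainty principle, subfactor case.) Let ψ ∈ ℂ^n ⊗ ℂ^d ⊗ ℂ^m be a unit vector with ρ := |ψ⟩⟨ψ|, and assume the reduced density matrices ρ_n and ρ_m are positive definite. Let σ be a positive definite density matrix on ℂ^d, set λ := Tr(σ⁻¹) and σ' := λ⁻¹ σ⁻¹. Then S(ρ_{nd} ‖ ρ_n ⊗ σ) + S(ρ_{dm} ‖ σ' ⊗ ρ_m) = log λ. -/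
open Matrix Kronecker ComplexOrder

/-- Functional-calculus logarithm of a Hermitian matrix (real log of eigenvalues,
with the convention `log 0 = 0`); defined to be `0` on non-Hermitian matrices. -/
noncomputable def matLog {ι : Type*} [Fintype ι] [DecidableEq ι] (A : Matrix ι ι ℂ) :
    Matrix ι ι ℂ :=
  if h : A.IsHermitian then
    (h.eigenvectorUnitary : Matrix ι ι ℂ) *
      Matrix.diagonal (fun i => (Real.log (h.eigenvalues i) : ℂ)) *
      star (h.eigenvectorUnitary : Matrix ι ι ℂ)
  else 0

/-- Relative entropy `S(ρ‖σ) = Tr(ρ (log ρ − log σ))`. -/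
noncomputable def relEnt {ι : Type*} [Fintype ι] [DecidableEq ι] (ρ σ : Matrix ι ι ℂ) : ℂ :=
  (ρ * (matLog ρ - matLog σ)).trace

/-- Partial trace over the second tensor factor. -/
noncomputable def ptraceR {a b : Type*} [Fintype b] (ρ : Matrix (a × b) (a × b) ℂ) :
    Matrix a a ℂ :=
  Matrix.of fun i i' => ∑ j : b, ρ (i, j) (i', j)

/-- Partial trace over the first tensor factor. -/
noncomputable def ptraceL {a b : Type*} [Fintype a] (ρ : Matrix (a × b) (a × b) ℂ) :
    Matrix b b ℂ :=
  Matrix.of fun j j' => ∑ i : a, ρ (i, j) (i, j')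

/-- Rank-one matrix `|ψ⟩⟨ψ|`. -/
noncomputable def outer {ι : Type*} (ψ : ι → ℂ) : Matrix ι ι ℂ :=
  Matrix.of fun x y => ψ x * (starRingEnd ℂ) (ψ y)

/-- Reduced matrix on the first factor `ℂ^n` of `ℂ^n ⊗ (ℂ^d ⊗ ℂ^m)`. -/
noncomputable def redN {n d m : ℕ}
    (ρ : Matrix (Fin n × Fin d × Fin m) (Fin n × Fin d × Fin m) ℂ) :
    Matrix (Fin n) (Fin n) ℂ := ptraceR ρ

/-- Reduced matrix on `ℂ^d ⊗ ℂ^m`. -/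
noncomputable def redDM {n d m : ℕ}
    (ρ : Matrix (Fin n × Fin d × Fin m) (Fin n × Fin d × Fin m) ℂ) :
    Matrix (Fin d × Fin m) (Fin d × Fin m) ℂ := ptraceL ρ

/-- Reduced matrix on `ℂ^d`. -/
noncomputable def redD {n d m : ℕ}
    (ρ : Matrix (Fin n × Fin d × Fin m) (Fin n × Fin d × Fin m) ℂ) :
    Matrix (Fin d) (Fin d) ℂ := ptraceR (ptraceL ρ)

/-- Reduced matrix on `ℂ^m`. -/
noncomputable def redM {n d m : ℕ}
    (ρ : Matrix (Fin n × Fin d × Fin m) (Fin n × Fin d × Fin m) ℂ) :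
    Matrix (Fin m) (Fin m) ℂ := ptraceL (ptraceL ρ)

/-- Reduced matrix on `ℂ^n ⊗ ℂ^d`. -/
noncomputable def redND {n d m : ℕ}
    (ρ : Matrix (Fin n × Fin d × Fin m) (Fin n × Fin d × Fin m) ℂ) :
    Matrix (Fin n × Fin d) (Fin n × Fin d) ℂ :=
  ptraceR (Matrix.reindex (Equiv.prodAssoc (Fin n) (Fin d) (Fin m)).symm
    (Equiv.prodAssoc (Fin n) (Fin d) (Fin m)).symm ρ)


lemma matLog_of_diag {ι : Type*} [Fintype ι] [DecidableEq ι] (A U : Matrix ι ι ℂ)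
    (hU : Uᴴ * U = 1) (a : ι → ℝ)
    (hA : A = U * Matrix.diagonal (fun i => (a i : ℂ)) * Uᴴ) :
    matLog A = U * Matrix.diagonal (fun i => (Real.log (a i) : ℂ)) * Uᴴ := by
  have hU' : U * Uᴴ = 1 := mul_eq_one_comm.mp hU
  have h : A.IsHermitian := by
    rw [Matrix.IsHermitian, hA]
    simp only [Matrix.conjTranspose_mul, Matrix.conjTranspose_conjTranspose,
      Matrix.diagonal_conjTranspose, Matrix.mul_assoc]
    congr 3
    ext i
    simp
  have hs := h.spectral_theorem
  rw [Unitary.conjStarAlgAut_apply] at hs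
  rw [matLog, dif_pos h]
  set W : Matrix ι ι ℂ := (h.eigenvectorUnitary : Matrix ι ι ℂ) with hW
  have hW1 : star W * W = 1 := Unitary.coe_star_mul_self _
  have hW2 : W * star W = 1 := Unitary.coe_mul_star_self _
  have key : (Uᴴ * W) * Matrix.diagonal (fun i => (h.eigenvalues i : ℂ))
      = Matrix.diagonal (fun i => (a i : ℂ)) * (Uᴴ * W) := by
    have h1 : A * W = W * Matrix.diagonal (fun i => (h.eigenvalues i : ℂ)) := by
      calc A * W = (W * Matrix.diagonal (fun i => (h.eigenvalues i : ℂ)) * star W) * W := by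
            congr 1
        _ = W * Matrix.diagonal (fun i => (h.eigenvalues i : ℂ)) * (star W * W) := by
            simp only [Matrix.mul_assoc]
        _ = _ := by rw [hW1, Matrix.mul_one]
    have h2 : Uᴴ * A = Matrix.diagonal (fun i => (a i : ℂ)) * Uᴴ := by
      rw [hA, ← Matrix.mul_assoc, ← Matrix.mul_assoc, hU, Matrix.one_mul]
    rw [Matrix.mul_assoc, ← h1, ← Matrix.mul_assoc, h2, Matrix.mul_assoc]
  have key2 : (Uᴴ * W) * Matrix.diagonal (fun i => (Real.log (h.eigenvalues i) : ℂ))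
      = Matrix.diagonal (fun i => (Real.log (a i) : ℂ)) * (Uᴴ * W) := by
    ext i j
    have := congrFun (congrFun key i) j
    rw [Matrix.mul_diagonal, Matrix.diagonal_mul] at this ⊢
    by_cases hz : (Uᴴ * W) i j = 0
    · simp [hz]
    · rw [mul_comm] at this
      have h3 := mul_right_cancel₀ hz this
      have h4 : h.eigenvalues j = a i := by exact_mod_cast h3
      rw [h4, mul_comm]
  calc W * Matrix.diagonal (fun i => (Real.log (h.eigenvalues i) : ℂ)) * star W
      = U * ((Uᴴ * W) * Matrix.diagonal (fun i => (Real.log (h.eigenvalues i) : ℂ))) * star W := by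
        rw [← Matrix.mul_assoc, ← Matrix.mul_assoc, hU', Matrix.one_mul]
    _ = U * Matrix.diagonal (fun i => (Real.log (a i) : ℂ)) * Uᴴ * (W * star W) := by
        rw [key2]; simp only [Matrix.mul_assoc]
    _ = _ := by rw [hW2, Matrix.mul_one]

lemma exists_diag {ι : Type*} [Fintype ι] [DecidableEq ι] {A : Matrix ι ι ℂ}
    (h : A.IsHermitian) : ∃ U : Matrix ι ι ℂ, Uᴴ * U = 1 ∧
      A = U * Matrix.diagonal (fun i => (h.eigenvalues i : ℂ)) * Uᴴ := by
  refine ⟨h.eigenvectorUnitary, Unitary.coe_star_mul_self _, ?_⟩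
  have hs := h.spectral_theorem
  rw [Unitary.conjStarAlgAut_apply] at hs
  exact hs

lemma matLog_kron {α β : Type*} [Fintype α] [DecidableEq α] [Fintype β] [DecidableEq β]
    {A : Matrix α α ℂ} {B : Matrix β β ℂ} (hA : A.PosDef) (hB : B.PosDef) :
    matLog (A ⊗ₖ B) = matLog A ⊗ₖ (1 : Matrix β β ℂ) + (1 : Matrix α α ℂ) ⊗ₖ matLog B := by
  obtain ⟨U, hU, hUA⟩ := exists_diag hA.1
  obtain ⟨V, hV, hVB⟩ := exists_diag hB.1
  have hU' : U * Uᴴ = 1 := mul_eq_one_comm.mp hU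
  have hV' : V * Vᴴ = 1 := mul_eq_one_comm.mp hV
  rw [matLog_of_diag A U hU _ hUA, matLog_of_diag B V hV _ hVB,
    matLog_of_diag (A ⊗ₖ B) (U ⊗ₖ V) ?_ (fun p => hA.1.eigenvalues p.1 * hB.1.eigenvalues p.2) ?_]
  · have e1 : (1 : Matrix β β ℂ) = V * 1 * Vᴴ := by rw [Matrix.mul_one, hV']
    have e2 : (1 : Matrix α α ℂ) = U * 1 * Uᴴ := by rw [Matrix.mul_one, hU']
    rw [e1, e2]
    simp only [Matrix.mul_kronecker_mul, ← Matrix.conjTranspose_kronecker]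
    rw [← Matrix.add_mul, ← Matrix.mul_add]
    congr 2
    rw [← Matrix.diagonal_one, ← Matrix.diagonal_one, Matrix.diagonal_kronecker_diagonal,
      Matrix.diagonal_kronecker_diagonal, Matrix.diagonal_add]
    congr 1
    ext p
    rw [Real.log_mul (hA.eigenvalues_pos _).ne' (hB.eigenvalues_pos _).ne']
    simp
  · rw [Matrix.conjTranspose_kronecker, ← Matrix.mul_kronecker_mul, hU, hV, Matrix.one_kronecker_one]
  · conv_lhs => rw [hUA, hVB]
    rw [Matrix.mul_kronecker_mul, Matrix.mul_kronecker_mul, Matrix.conjTranspose_kronecker,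
      Matrix.diagonal_kronecker_diagonal]
    simp

lemma matLog_smul_inv {α : Type*} [Fintype α] [DecidableEq α]
    {A : Matrix α α ℂ} (hA : A.PosDef) (l : ℝ) (hl : 0 < l) :
    matLog ((l : ℂ)⁻¹ • A⁻¹) = -((Real.log l : ℂ) • (1 : Matrix α α ℂ)) - matLog A := by
  obtain ⟨U, hU, hUA⟩ := exists_diag hA.1
  have hU' : U * Uᴴ = 1 := mul_eq_one_comm.mp hU
  have hinv : A⁻¹ = U * Matrix.diagonal (fun i => ((hA.1.eigenvalues i)⁻¹ : ℂ)) * Uᴴ := by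
    apply Matrix.inv_eq_right_inv
    calc A * (U * Matrix.diagonal (fun i => ((hA.1.eigenvalues i)⁻¹ : ℂ)) * Uᴴ)
        = U * (Matrix.diagonal (fun i => (hA.1.eigenvalues i : ℂ)) * ((Uᴴ * U) *
          Matrix.diagonal (fun i => ((hA.1.eigenvalues i)⁻¹ : ℂ)))) * Uᴴ := by
          conv_lhs => enter [1]; rw [hUA]
          simp only [Matrix.mul_assoc]
      _ = 1 := by
          rw [hU, Matrix.one_mul, Matrix.diagonal_mul_diagonal]
          have : (fun i => (hA.1.eigenvalues i : ℂ) * (hA.1.eigenvalues i : ℂ)⁻¹) = fun _ => 1 := by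
            ext i
            exact mul_inv_cancel₀ (by exact_mod_cast (hA.eigenvalues_pos i).ne')
          rw [this, Matrix.diagonal_one, Matrix.mul_one, hU']
  rw [matLog_of_diag A U hU _ hUA,
    matLog_of_diag _ U hU (fun i => l⁻¹ * (hA.1.eigenvalues i)⁻¹) ?_]
  · have e : -((Real.log l : ℂ) • (1 : Matrix α α ℂ))
        = U * Matrix.diagonal (fun _ => -(Real.log l : ℂ)) * Uᴴ := by
      have : Matrix.diagonal (fun _ : α => -(Real.log l : ℂ))
          = -((Real.log l : ℂ) • (1 : Matrix α α ℂ)) := by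
        rw [Matrix.smul_one_eq_diagonal, Matrix.diagonal_neg]
      rw [this]
      simp [hU']
    rw [e, ← Matrix.sub_mul, ← Matrix.mul_sub, Matrix.diagonal_sub]
    congr 3
    ext i
    rw [Real.log_mul (inv_pos.mpr hl).ne' (inv_pos.mpr (hA.eigenvalues_pos _)).ne',
      Real.log_inv, Real.log_inv]
    push_cast
    ring
  · rw [hinv, ← Matrix.smul_mul, ← Matrix.mul_smul, ← Matrix.diagonal_smul]
    congr 3
    ext i
    simp

lemma trace_mul_matLog {ι : Type*} [Fintype ι] [DecidableEq ι] {A : Matrix ι ι ℂ}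
    (h : A.IsHermitian) :
    (A * matLog A).trace = (A.charpoly.roots.map (fun z => z * (Real.log z.re : ℂ))).sum := by
  obtain ⟨U, hU, hUA⟩ := exists_diag h
  rw [matLog_of_diag A U hU _ hUA, h.roots_charpoly_eq_eigenvalues]
  calc (A * (U * Matrix.diagonal (fun i => (Real.log (h.eigenvalues i) : ℂ)) * Uᴴ)).trace
      = (U * (Matrix.diagonal (fun i => (h.eigenvalues i : ℂ)) * ((Uᴴ * U) *
          Matrix.diagonal (fun i => (Real.log (h.eigenvalues i) : ℂ))) * Uᴴ)).trace := by
          conv_lhs => enter [1, 1]; rw [hUA]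
          simp only [Matrix.mul_assoc]
    _ = _ := by
      rw [Matrix.trace_mul_comm, Matrix.mul_assoc, hU, Matrix.mul_one, Matrix.one_mul,
        Matrix.diagonal_mul_diagonal, Matrix.trace_diagonal]
      rw [Multiset.map_map, Finset.sum]
      rfl

lemma entropy_eq {p q : Type*} [Fintype p] [DecidableEq p] [Fintype q] [DecidableEq q]
    (M : Matrix p q ℂ) {A : Matrix p p ℂ} {B : Matrix q q ℂ} (hA : A = M * Mᴴ)
    (hB : B = (Mᴴ * M)ᵀ) : (A * matLog A).trace = (B * matLog B).trace := by
  have hA' : A.IsHermitian := by rw [hA]; exact Matrix.isHermitian_mul_conjTranspose_self M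
  have hB' : B.IsHermitian := by
    rw [hB]; exact (Matrix.isHermitian_conjTranspose_mul_self M).transpose
  rw [trace_mul_matLog hA', trace_mul_matLog hB']
  have h := Matrix.charpoly_mul_comm' M Mᴴ
  rw [← hA, ← Matrix.charpoly_transpose (Mᴴ * M), ← hB] at h
  have h2 := congrArg (fun P => (P.roots.map (fun z : ℂ => z * (Real.log z.re : ℂ))).sum) h
  rw [Polynomial.roots_mul (mul_ne_zero (by simp) (Matrix.charpoly_monic _).ne_zero),
    Polynomial.roots_mul (mul_ne_zero (by simp) (Matrix.charpoly_monic _).ne_zero)] at h2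
  simpa [Multiset.map_nsmul, Multiset.sum_nsmul] using h2

lemma trace_kron_right {α β : Type*} [Fintype α] [DecidableEq α] [Fintype β] [DecidableEq β]
    (R : Matrix (α × β) (α × β) ℂ) (X : Matrix α α ℂ) :
    (R * (X ⊗ₖ (1 : Matrix β β ℂ))).trace = (ptraceR R * X).trace := by
  simp only [Matrix.trace, Matrix.diag, Matrix.mul_apply, Fintype.sum_prod_type, ptraceR,
    Matrix.kroneckerMap_apply, Matrix.of_apply, Matrix.one_apply, mul_ite, mul_one, mul_zero,
    Finset.sum_ite_eq', Finset.mem_univ, if_true, Finset.sum_mul]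
  refine Finset.sum_congr rfl fun i _ => ?_
  rw [Finset.sum_comm]

lemma trace_kron_left {α β : Type*} [Fintype α] [DecidableEq α] [Fintype β] [DecidableEq β]
    (R : Matrix (α × β) (α × β) ℂ) (X : Matrix β β ℂ) :
    (R * ((1 : Matrix α α ℂ) ⊗ₖ X)).trace = (ptraceL R * X).trace := by
  simp only [Matrix.trace, Matrix.diag, Matrix.mul_apply, Fintype.sum_prod_type, ptraceL,
    Matrix.kroneckerMap_apply, Matrix.of_apply, Matrix.one_apply, ite_mul, one_mul, zero_mul,
    mul_ite, mul_zero, Finset.sum_mul]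
  rw [Finset.sum_comm]
  refine Finset.sum_congr rfl fun j _ => ?_
  rw [Finset.sum_comm]
  rw [Finset.sum_comm]
  simp
  rw [Finset.sum_comm]

/-- **Entropic certainty principle (subfactor case):** for a unit vector
`ψ ∈ ℂⁿ ⊗ ℂᵈ ⊗ ℂᵐ` with `ρ = |ψ⟩⟨ψ|`, a positive definite density matrix `σ` on `ℂᵈ`,
`λ = Tr(σ⁻¹)` (written as the real number `l`) and `σ' = λ⁻¹ σ⁻¹`,
`S(ρ_nd ‖ ρ_n ⊗ σ) + S(ρ_dm ‖ σ' ⊗ ρ_m) = log λ`. -/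
theorem stmt8 {n d m : ℕ} (ψ : Fin n × Fin d × Fin m → ℂ)
    (hψ : ∑ x, Complex.normSq (ψ x) = 1)
    (hρn : (redN (outer ψ)).PosDef) (hρm : (redM (outer ψ)).PosDef)
    (σ : Matrix (Fin d) (Fin d) ℂ)
    (hσ : σ.PosDef) (hσtr : σ.trace = 1)
    (l : ℝ) (hl : (σ⁻¹).trace = (l : ℂ))
    (σ' : Matrix (Fin d) (Fin d) ℂ) (hσ' : σ' = (l : ℂ)⁻¹ • σ⁻¹) :
    relEnt (redND (outer ψ)) (redN (outer ψ) ⊗ₖ σ)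
      + relEnt (redDM (outer ψ)) (σ' ⊗ₖ redM (outer ψ))
      = (Real.log l : ℂ) := by
  have hl0 : 0 < l := by
    have hne : Nonempty (Fin d) := by
      by_contra hne
      rw [not_nonempty_iff] at hne
      simp [Matrix.trace] at hσtr
    have := hσ.inv.trace_pos
    rw [hl] at this
    exact_mod_cast this
  have hlc : (0 : ℂ) < (l : ℂ)⁻¹ := by
    rw [← Complex.ofReal_inv]
    exact_mod_cast inv_pos.mpr hl0
  have hσ'p : σ'.PosDef := by rw [hσ']; exact hσ.inv.smul hlc
  have hlog : matLog σ' = -((Real.log l : ℂ) • (1 : Matrix (Fin d) (Fin d) ℂ)) - matLog σ := by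
    rw [hσ']; exact matLog_smul_inv hσ l hl0
  have n1 : ptraceR (redND (outer ψ)) = redN (outer ψ) := by
    ext i i'
    simp [ptraceR, redND, redN, Fintype.sum_prod_type]
  have d1 : ptraceL (redND (outer ψ)) = redD (outer ψ) := by
    ext i i'
    simp only [ptraceR, redND, redD, ptraceL, Matrix.of_apply, Matrix.reindex_apply,
      Matrix.submatrix_apply, Equiv.symm_symm, Equiv.prodAssoc_apply]
    rw [Finset.sum_comm]
  have d2 : ptraceR (redDM (outer ψ)) = redD (outer ψ) := rfl
  have m2 : ptraceL (redDM (outer ψ)) = redM (outer ψ) := rfl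
  have htr : (redD (outer ψ)).trace = 1 := by
    have : ((∑ x, Complex.normSq (ψ x) : ℝ) : ℂ) = 1 := by rw [hψ]; simp
    rw [← this]
    simp only [Matrix.trace, Matrix.diag, redD, ptraceR, ptraceL, outer, Matrix.of_apply,
      Complex.mul_conj, Fintype.sum_prod_type, Complex.ofReal_sum]
    conv_rhs => rw [Finset.sum_comm]
    refine Finset.sum_congr rfl fun j _ => ?_
    rw [Finset.sum_comm]
  have s1 : (redND (outer ψ) * matLog (redND (outer ψ))).trace
      = (redM (outer ψ) * matLog (redM (outer ψ))).trace := by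
    refine entropy_eq (Matrix.of fun (p : Fin n × Fin d) (k : Fin m) => ψ (p.1, p.2, k)) ?_ ?_
    · ext p p'
      simp [redND, ptraceR, outer, Matrix.mul_apply]
    · ext p p'
      simp only [redM, ptraceL, outer, Matrix.mul_apply, Matrix.of_apply, Matrix.transpose_apply,
        Matrix.conjTranspose_apply, Fintype.sum_prod_type]
      rw [Finset.sum_comm]
      simp [mul_comm]
  have s2 : (redN (outer ψ) * matLog (redN (outer ψ))).trace
      = (redDM (outer ψ) * matLog (redDM (outer ψ))).trace := by
    refine entropy_eq (Matrix.of fun (p : Fin n) (k : Fin d × Fin m) => ψ (p, k)) ?_ ?_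
    · ext p p'
      simp [redN, ptraceR, outer, Matrix.mul_apply]
    · ext p p'
      simp [redDM, ptraceL, outer, Matrix.mul_apply, mul_comm]
  rw [relEnt, relEnt, matLog_kron hρn hσ, matLog_kron hσ'p hρm]
  simp only [Matrix.mul_sub, Matrix.mul_add, Matrix.trace_sub, Matrix.trace_add,
    trace_kron_right, trace_kron_left, n1, d1, d2, m2, s1, s2, hlog, Matrix.mul_neg,
    Matrix.trace_neg, Matrix.mul_smul, Matrix.trace_smul, Matrix.mul_one, htr, smul_eq_mul]
  ring
end

section
/- Let ψ ∈ ℂ^n ⊗ ℂ^d ⊗ ℂ^m be a unit vector with ρ := |ψ⟩⟨ψ|, and assume the reduced density matrices ρ_n and ρ_m are positive definite. Let σ be a positive definite density matrix on ℂ^d. Then S(ρ_{nd} ‖ ρ_n ⊗ σ) ≤ log Tr(σ⁻¹). -/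
open Matrix Kronecker ComplexOrder

open Finset in
lemma real_core {ι : Type*} [Fintype ι] (a b : ι → ℝ) (p : ι → ι → ℝ) (l : ℝ) (hl : 0 < l)
    (ha : ∀ i, 0 ≤ a i) (hb : ∀ i, 0 < b i) (hp : ∀ i j, 0 ≤ p i j)
    (hp1 : ∀ i, ∑ j, p i j = 1) (hsum : ∑ i, a i = 1)
    (hq : ∀ i, a i * ∑ j, p i j / b j ≤ l) :
    ∑ i, a i * Real.log (a i) - ∑ i, ∑ j, a i * p i j * Real.log (b j) ≤ Real.log l := by
  have h1 : ∑ i, a i * Real.log (a i) - ∑ i, ∑ j, a i * p i j * Real.log (b j)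
      = ∑ i, ∑ j, a i * p i j * (Real.log (a i) - Real.log (b j)) := by
    rw [← Finset.sum_sub_distrib]
    refine Finset.sum_congr rfl fun i _ => ?_
    simp only [mul_sub, Finset.sum_sub_distrib]
    rw [← Finset.sum_mul, ← Finset.mul_sum, hp1, mul_one]
  have h2 : ∀ i j, a i * p i j * (Real.log (a i) - Real.log (b j)) ≤
      a i * p i j * (Real.log l - 1) + a i * a i * (p i j / b j) / l := by
    intro i j
    rcases (ha i).eq_or_lt with h | h
    · simp [← h]
    · have := Real.log_le_sub_one_of_pos (x := a i / (b j * l)) (by have := hb j; positivity)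
      rw [Real.log_div h.ne' (by have := hb j; positivity),
        Real.log_mul (hb j).ne' hl.ne'] at this
      have h3 := mul_le_mul_of_nonneg_left this (mul_nonneg (ha i) (hp i j))
      have h4 : a i * a i * (p i j / b j) / l = a i * p i j * (a i / (b j * l)) := by
        have := (hb j).ne'
        field_simp
      rw [h4]
      nlinarith
  have h3 : ∀ i, ∑ j, (a i * p i j * (Real.log l - 1) + a i * a i * (p i j / b j) / l) ≤
      a i * Real.log l := by
    intro i
    rw [Finset.sum_add_distrib, ← Finset.sum_mul, ← Finset.mul_sum, hp1, ← Finset.sum_div,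
      ← Finset.mul_sum]
    have : a i * a i * (∑ j, p i j / b j) / l ≤ a i := by
      rw [div_le_iff₀ hl, mul_assoc]
      exact mul_le_mul_of_nonneg_left (hq i) (ha i)
    linarith
  rw [h1]
  calc _ ≤ ∑ i, a i * Real.log l :=
        Finset.sum_le_sum fun i _ => (Finset.sum_le_sum fun j _ => h2 i j).trans (h3 i)
    _ = _ := by rw [← Finset.sum_mul, hsum, one_mul]

lemma cs_core {κ : Type*} [Fintype κ] [DecidableEq κ] (s M : Matrix κ κ ℂ) (hs : s.PosDef)
    (l : ℝ) (hlp : 0 < l) (hl : (s⁻¹).trace = (l : ℂ)) :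
    M.trace * star M.trace ≤ (l : ℂ) * (Mᴴ * s * M).trace := by
  have hdet : IsUnit s.det := (Matrix.isUnit_iff_isUnit_det s).1 hs.isUnit
  have hl0 : (l : ℂ) ≠ 0 := by exact_mod_cast hlp.ne'
  set t : ℂ := M.trace / l with ht
  have h0 : 0 ≤ ((s * M - t • 1)ᴴ * s⁻¹ * (s * M - t • 1)).trace :=
    (hs.inv.posSemidef.conjTranspose_mul_mul_same _).trace_nonneg
  have h1 : (s * M - t • 1)ᴴ * s⁻¹ * (s * M - t • 1) =
      Mᴴ * s * M - t • Mᴴ - star t • M + (star t * t) • s⁻¹ := by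
    rw [conjTranspose_sub, conjTranspose_mul, hs.1.eq, conjTranspose_smul, conjTranspose_one]
    have e1 : Mᴴ * s * s⁻¹ = Mᴴ := by rw [Matrix.mul_assoc, Matrix.mul_nonsing_inv _ hdet, Matrix.mul_one]
    have e2 : s⁻¹ * (s * M) = M := by rw [← Matrix.mul_assoc, Matrix.nonsing_inv_mul _ hdet, Matrix.one_mul]
    rw [sub_mul, sub_mul, e1]
    simp only [mul_sub, Matrix.smul_mul, Matrix.one_mul, Matrix.mul_smul, Matrix.mul_one, e2, smul_smul]
    rw [← Matrix.mul_assoc, mul_comm t]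
    abel
  rw [h1] at h0
  simp only [trace_add, trace_sub, trace_smul, smul_eq_mul, trace_conjTranspose, hl] at h0
  have h2 := mul_nonneg (show (0:ℂ) ≤ l by exact_mod_cast hlp.le) h0
  rw [← sub_nonneg]
  convert h2 using 1
  have : star t = star M.trace / l := by simp [ht]
  rw [this, ht]
  field_simp
  ring
lemma sum_nd {n d m : ℕ} (ψ : Fin n × Fin d × Fin m → ℂ) (x : Fin n × Fin d → ℂ) :
    star x ⬝ᵥ (redND (outer ψ) *ᵥ x) = 
     ∑ k, ((Matrix.of fun i j => x (i,j))ᴴ * (Matrix.of fun i j => ψ (i,j,k))).trace * 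
      star ((Matrix.of fun i j => x (i,j))ᴴ * (Matrix.of fun i j => ψ (i,j,k))).trace := by
  have h : ∀ k, ((Matrix.of fun i j => x (i,j))ᴴ * (Matrix.of fun i j => ψ (i,j,k))).trace =
      ∑ y : Fin n × Fin d, star (x y) * ψ (y.1, y.2, k) := by
    intro k
    simp only [Matrix.trace, Matrix.diag, Matrix.mul_apply, conjTranspose_apply, of_apply, Fintype.sum_prod_type]
    rw [Finset.sum_comm]
  simp only [h, redND, ptraceR, outer, dotProduct, mulVec, of_apply, reindex_apply, submatrix_apply,
    star_sum, star_mul', star_star, Finset.sum_mul_sum, Pi.star_apply]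
  rw [Finset.sum_comm]
  refine Finset.sum_congr rfl fun y _ => ?_
  rw [Finset.sum_comm, Finset.mul_sum]
  refine Finset.sum_congr rfl fun z _ => ?_
  rw [Finset.sum_mul, Finset.mul_sum]
  refine Finset.sum_congr rfl fun k _ => ?_
  simp [Equiv.prodAssoc]
  ring

lemma sum_n {n d m : ℕ} (ψ : Fin n × Fin d × Fin m → ℂ) (x : Fin n × Fin d → ℂ) 
    (σ : Matrix (Fin d) (Fin d) ℂ) :
    star x ⬝ᵥ ((redN (outer ψ) ⊗ₖ σ) *ᵥ x) = 
     ∑ k, (((Matrix.of fun i j => x (i,j))ᴴ * (Matrix.of fun i j => ψ (i,j,k)))ᴴ * σᵀ * 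
      ((Matrix.of fun i j => x (i,j))ᴴ * (Matrix.of fun i j => ψ (i,j,k)))).trace := by
  simp only [redN, ptraceR, outer, dotProduct, mulVec, of_apply, kroneckerMap_apply, 
    Pi.star_apply, Matrix.trace, Matrix.diag, Matrix.mul_apply, conjTranspose_apply, transpose_apply,
    star_sum, star_mul', star_star, Finset.sum_mul, Finset.mul_sum, Fintype.sum_prod_type]
  simp only [← Fintype.sum_prod_type']
  refine Fintype.sum_equiv 
    ⟨fun ⟨i,j,i',j',c,k⟩ => ⟨k,c,j,i,j',i'⟩, fun ⟨k,c,j,i,j',i'⟩ => ⟨i,j,i',j',c,k⟩, 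
      fun _ => rfl, fun _ => rfl⟩ _ _ ?_
  rintro ⟨i,j,i',j',c,k⟩
  simp
  ring
lemma trace_conj_diag {ι : Type*} [Fintype ι] [DecidableEq ι] (U V : Matrix ι ι ℂ) (a c : ι → ℂ) :
    ((U * diagonal a * star U) * (V * diagonal c * star V)).trace =
      ∑ i, ∑ j, a i * ((star U * V) i j * star ((star U * V) i j)) * c j := by
  have : ((U * diagonal a * star U) * (V * diagonal c * star V)).trace =
      ((diagonal a * (star U * V) * diagonal c) * star (star U * V)).trace := by
    rw [star_mul, star_star]
    calc _ = (U * (diagonal a * star U * V * diagonal c * star V)).trace := by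
          simp only [Matrix.mul_assoc]
      _ = _ := by rw [Matrix.trace_mul_comm]; simp only [Matrix.mul_assoc]
  rw [this]
  simp only [Matrix.trace, Matrix.diag]
  refine Finset.sum_congr rfl fun i _ => ?_
  rw [Matrix.mul_apply]
  refine Finset.sum_congr rfl fun j _ => ?_
  rw [Matrix.mul_diagonal, Matrix.diagonal_mul, Matrix.star_apply]
  ring

lemma relEnt_le_of_le {ι : Type*} [Fintype ι] [DecidableEq ι] (A B : Matrix ι ι ℂ)
    (hA : A.PosSemidef) (hB : B.PosDef) (htr : A.trace = 1) (l : ℝ) (hl : 0 < l)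
    (hle : ∀ x : ι → ℂ, star x ⬝ᵥ (A *ᵥ x) ≤ (l : ℂ) * (star x ⬝ᵥ (B *ᵥ x))) :
    relEnt A B ≤ (Real.log l : ℂ) := by
  have hAs := hA.1.spectral_theorem
  have hBs := hB.1.spectral_theorem
  rw [Unitary.conjStarAlgAut_apply] at hAs hBs
  have hUU : star (hA.1.eigenvectorUnitary : Matrix ι ι ℂ) * (hA.1.eigenvectorUnitary : Matrix ι ι ℂ) = 1 :=
    Unitary.coe_star_mul_self _
  have hVV : star (hB.1.eigenvectorUnitary : Matrix ι ι ℂ) * (hB.1.eigenvectorUnitary : Matrix ι ι ℂ) = 1 :=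
    Unitary.coe_star_mul_self _
  have hVV' : (hB.1.eigenvectorUnitary : Matrix ι ι ℂ) * star (hB.1.eigenvectorUnitary : Matrix ι ι ℂ) = 1 :=
    Unitary.coe_mul_star_self _
  have ha := hA.eigenvalues_nonneg
  have hb := hB.eigenvalues_pos
  have hsum : ∑ i, hA.1.eigenvalues i = 1 := by
    have := hA.1.trace_eq_sum_eigenvalues
    rw [htr] at this
    have h2 := congrArg Complex.re this
    simpa using h2.symm
  have hlogA : matLog A = (hA.1.eigenvectorUnitary : Matrix ι ι ℂ) *
      Matrix.diagonal (fun i => (Real.log (hA.1.eigenvalues i) : ℂ)) *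
      star (hA.1.eigenvectorUnitary : Matrix ι ι ℂ) := by rw [matLog, dif_pos hA.1]
  have hlogB : matLog B = (hB.1.eigenvectorUnitary : Matrix ι ι ℂ) *
      Matrix.diagonal (fun i => (Real.log (hB.1.eigenvalues i) : ℂ)) *
      star (hB.1.eigenvectorUnitary : Matrix ι ι ℂ) := by rw [matLog, dif_pos hB.1]
  generalize hA.1.eigenvalues = a at *
  generalize hB.1.eigenvalues = b at *
  generalize (hA.1.eigenvectorUnitary : Matrix ι ι ℂ) = U at *
  generalize (hB.1.eigenvectorUnitary : Matrix ι ι ℂ) = V at *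
  set W := star U * V with hW
  have hWW : W * star W = 1 := by
    rw [hW, star_mul, star_star, Matrix.mul_assoc, ← Matrix.mul_assoc V, hVV', Matrix.one_mul, hUU]
  have hp1 : ∀ i, ∑ j, Complex.normSq (W i j) = 1 := by
    intro i
    have := congrFun (congrFun hWW i) i
    rw [Matrix.mul_apply, Matrix.one_apply_eq] at this
    simp only [Matrix.star_apply, Complex.star_def, Complex.mul_conj] at this
    exact_mod_cast this
  have e1 : (A * matLog A).trace = ((∑ i, a i * Real.log (a i) : ℝ) : ℂ) := by
    rw [hlogA]
    conv_lhs => rw [hAs]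
    rw [trace_conj_diag, hUU]
    push_cast
    refine Finset.sum_congr rfl fun i _ => ?_
    rw [Finset.sum_eq_single i]
    · simp
    · intro j _ hj
      simp [Matrix.one_apply_ne hj.symm]
    · simp
  have e2 : (A * matLog B).trace =
      ((∑ i, ∑ j, a i * Complex.normSq (W i j) * Real.log (b j) : ℝ) : ℂ) := by
    rw [hlogB]
    conv_lhs => rw [hAs]
    rw [trace_conj_diag, ← hW]
    push_cast
    simp only [Complex.star_def, Complex.mul_conj]
    rfl
  rw [relEnt, mul_sub, trace_sub, e1, e2, ← Complex.ofReal_sub, Complex.real_le_real]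
  refine real_core a b (fun i j => Complex.normSq (W i j)) l hl ha hb
    (fun i j => Complex.normSq_nonneg _) hp1 hsum ?_
  intro i
  set q := ∑ j, Complex.normSq (W i j) / b j with hq
  have hq0 : 0 ≤ q := Finset.sum_nonneg fun j _ => div_nonneg (Complex.normSq_nonneg _) (hb j).le
  let y : ι → ℂ := fun j => star (W i j) / b j
  have hquad : ∀ (X : Matrix ι ι ℂ) (c : ι → ℝ) (z : ι → ℂ),
      star z ⬝ᵥ ((X * diagonal (RCLike.ofReal ∘ c) * star X) *ᵥ z) =
       ((∑ k, c k * Complex.normSq ((star X *ᵥ z) k) : ℝ) : ℂ) := by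
    intro X c z
    rw [← Matrix.mulVec_mulVec, ← Matrix.mulVec_mulVec, Matrix.dotProduct_mulVec]
    have : star z ᵥ* X = star (star X *ᵥ z) := by
      rw [Matrix.star_mulVec, star_eq_conjTranspose, conjTranspose_conjTranspose]
    rw [this]
    push_cast
    simp only [dotProduct, mulVec_diagonal, Pi.star_apply]
    refine Finset.sum_congr rfl fun k _ => ?_
    rw [← Complex.mul_conj]
    simp
    ring
  have h := hle (V *ᵥ y)
  have hBy : star (V *ᵥ y) ⬝ᵥ (B *ᵥ (V *ᵥ y)) = (q : ℂ) := by
    rw [hBs, hquad, Matrix.mulVec_mulVec, hVV, Matrix.one_mulVec, hq]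
    congr 1
    refine Finset.sum_congr rfl fun k _ => ?_
    have := (hb k).ne'
    simp only [y, Complex.normSq_div, Complex.normSq_ofReal, Complex.star_def, Complex.normSq_conj]
    field_simp
  rw [hBy, hAs, hquad, Matrix.mulVec_mulVec, ← hW, ← Complex.ofReal_mul, Complex.real_le_real] at h
  have hWy : (W *ᵥ y) i = (q : ℂ) := by
    rw [hq]
    push_cast
    simp only [mulVec, dotProduct, y]
    refine Finset.sum_congr rfl fun k _ => ?_
    rw [← Complex.mul_conj, Complex.star_def, mul_div_assoc]
  have h2 : a i * Complex.normSq ((W *ᵥ y) i) ≤ l * q :=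
    (Finset.single_le_sum (f := fun k => a k * Complex.normSq ((W *ᵥ y) k))
      (fun k _ => mul_nonneg (ha k) (Complex.normSq_nonneg _)) (Finset.mem_univ i)).trans h
  rw [hWy, Complex.normSq_ofReal] at h2
  rcases hq0.eq_or_lt with h0 | h0
  · rw [← h0, mul_zero]; exact hl.le
  · exact le_of_mul_le_mul_right (by linarith) h0

/-- **Pimsner–Popa-type bound from the entropic certainty:** for a unit vector
`ψ ∈ ℂⁿ ⊗ ℂᵈ ⊗ ℂᵐ` with `ρ = |ψ⟩⟨ψ|` and a positive definite density matrix `σ` on `ℂᵈ`,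
`S(ρ_nd ‖ ρ_n ⊗ σ) ≤ log Tr(σ⁻¹)` (`Tr(σ⁻¹)` is written as the real number `l`;
the inequality is in the complex order, so in particular the relative entropy is real). -/
theorem stmt9 {n d m : ℕ} (ψ : Fin n × Fin d × Fin m → ℂ)
    (hψ : ∑ x, Complex.normSq (ψ x) = 1)
    (hρn : (redN (outer ψ)).PosDef) (hρm : (redM (outer ψ)).PosDef)
    (σ : Matrix (Fin d) (Fin d) ℂ)
    (hσ : σ.PosDef) (hσtr : σ.trace = 1)
    (l : ℝ) (hl : (σ⁻¹).trace = (l : ℂ)) :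
    relEnt (redND (outer ψ)) (redN (outer ψ) ⊗ₖ σ) ≤ (Real.log l : ℂ) := by
  have hσt : σᵀ.PosDef := hσ.transpose
  have hlt : ((σᵀ)⁻¹).trace = (l : ℂ) := by
    rw [← Matrix.transpose_nonsing_inv, Matrix.trace_transpose, hl]
  have hd : Nonempty (Fin d) := by
    by_contra hne
    rw [not_nonempty_iff] at hne
    simp [Matrix.trace] at hσtr
  have hlp : 0 < l := by
    have h0 : 0 < (σ⁻¹).trace := Finset.sum_pos (fun i _ => hσ.inv.diag_pos) Finset.univ_nonempty
    rw [hl] at h0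
    exact_mod_cast h0
  have hHerm : (redND (outer ψ)).IsHermitian := by
    ext y z
    simp [redND, ptraceR, outer, mul_comm]
  refine relEnt_le_of_le _ _ ?_ (hρn.kronecker hσ) ?_ l hlp ?_
  · refine PosSemidef.of_dotProduct_mulVec_nonneg hHerm fun x => ?_
    rw [sum_nd]
    exact Finset.sum_nonneg fun k _ => mul_star_self_nonneg _
  · have h1 : ((∑ x, Complex.normSq (ψ x) : ℝ) : ℂ) = 1 := by rw [hψ]; simp
    rw [← h1]
    push_cast
    simp only [Matrix.trace, Matrix.diag, redND, ptraceR, outer, of_apply, reindex_apply,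
      submatrix_apply, Complex.mul_conj, Fintype.sum_prod_type]
    rfl
  · intro x
    rw [sum_nd, sum_n, Finset.mul_sum]
    exact Finset.sum_le_sum fun k _ => cs_core σᵀ _ hσt l hlp hlt
end

section
/- Let ρ and σ be d×d density matrices with σ positive definite, and let μ > 0 be such that σ − μρ is positive semidefinite. Then the relative entropy satisfies S(ρ ‖ σ) ≤ log(1/μ). -/
open Matrix ComplexOrder

/-- Per-eigenvector bound. -/
theorem aux_term {d : ℕ} (W : Matrix (Fin d) (Fin d) ℂ) (hW : star W * W = 1)
    (p q : Fin d → ℝ) (hp : ∀ i, 0 ≤ p i) (hq : ∀ i, 0 < q i) (μ : ℝ) (hμ : 0 < μ)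
    (hdom : (Matrix.diagonal (fun i => (q i : ℂ)) -
      (μ : ℂ) • (W * Matrix.diagonal (fun i => (p i : ℂ)) * star W)).PosSemidef) (i : Fin d) :
    p i * (Real.log (p i) - ∑ j, Complex.normSq (W j i) * Real.log (q j))
      ≤ p i * Real.log (1 / μ) := by
  rcases (hp i).eq_or_lt with h0 | hpos
  · simp [← h0]
  have hcol : ∑ j, Complex.normSq (W j i) = 1 := by
    have h := congrFun (congrFun hW i) i
    simp only [Matrix.mul_apply, Matrix.star_apply, Matrix.one_apply_eq] at h
    have h2 : ((∑ j, Complex.normSq (W j i) : ℝ) : ℂ) = 1 := by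
      rw [← h]
      push_cast
      exact Finset.sum_congr rfl fun j _ => Complex.normSq_eq_conj_mul_self
    exact_mod_cast h2
  set s : ℝ := ∑ j, Complex.normSq (W j i) / q j with hs
  have hs0 : 0 ≤ s := Finset.sum_nonneg fun j _ => div_nonneg (Complex.normSq_nonneg _) (hq j).le
  let x : Fin d → ℂ := fun j => W j i / q j
  let y : Fin d → ℂ := star W *ᵥ x
  have hyi : y i = (s : ℂ) := by
    simp only [y, x, Matrix.mulVec, dotProduct, Matrix.star_apply, hs]
    push_cast
    refine Finset.sum_congr rfl fun j _ => ?_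
    rw [Complex.normSq_eq_conj_mul_self, mul_div_assoc]
    rfl
  have hxQ : star x ⬝ᵥ (Matrix.diagonal (fun i => (q i : ℂ)) *ᵥ x) = (s : ℂ) := by
    simp only [x, dotProduct, Matrix.mulVec_diagonal, Pi.star_apply, hs]
    push_cast
    refine Finset.sum_congr rfl fun j _ => ?_
    have : (q j : ℂ) ≠ 0 := by exact_mod_cast (hq j).ne'
    rw [Complex.normSq_eq_conj_mul_self, star_div₀]
    simp only [Complex.star_def, Complex.conj_ofReal]
    field_simp
  have hxP : star x ⬝ᵥ ((W * Matrix.diagonal (fun i => (p i : ℂ)) * star W) *ᵥ x)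
      = ((∑ k, p k * Complex.normSq (y k) : ℝ) : ℂ) := by
    rw [← Matrix.mulVec_mulVec, ← Matrix.mulVec_mulVec, Matrix.dotProduct_mulVec]
    have : star x ᵥ* W = star y := by
      simp only [y, Matrix.star_mulVec, Matrix.star_eq_conjTranspose,
        Matrix.conjTranspose_conjTranspose]
    rw [this]
    change star y ⬝ᵥ (Matrix.diagonal (fun i => (p i : ℂ)) *ᵥ y) = _
    simp only [dotProduct, Matrix.mulVec_diagonal, Pi.star_apply]
    push_cast
    refine Finset.sum_congr rfl fun j _ => ?_
    rw [Complex.normSq_eq_conj_mul_self]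
    simp only [Complex.star_def]
    ring
  have h1 := hdom.dotProduct_mulVec_nonneg x
  rw [Matrix.sub_mulVec, Matrix.smul_mulVec, dotProduct_sub, dotProduct_smul, hxQ, hxP,
    smul_eq_mul] at h1
  have h2 : 0 ≤ s - μ * ∑ k, p k * Complex.normSq (y k) := by exact_mod_cast h1
  have h3 : p i * s ^ 2 ≤ ∑ k, p k * Complex.normSq (y k) := by
    have := Finset.single_le_sum (f := fun k => p k * Complex.normSq (y k))
      (fun k _ => mul_nonneg (hp k) (Complex.normSq_nonneg _)) (Finset.mem_univ i)
    simp only [hyi, Complex.normSq_ofReal] at this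
    linarith [this, sq s]
  have h4 : μ * p i * s ≤ 1 := by
    have h5 : μ * (p i * s ^ 2) ≤ s := by nlinarith
    rcases hs0.eq_or_lt with h | h
    · rw [← h]; simp
    · by_contra! hc
      nlinarith
  apply mul_le_mul_of_nonneg_left _ hpos.le
  have hlog : ∀ j, Real.log (p i) + Real.log μ - Real.log (q j) ≤ μ * p i / q j - 1 := by
    intro j
    have := Real.log_le_sub_one_of_pos (div_pos (mul_pos hμ hpos) (hq j))
    rw [Real.log_div (mul_pos hμ hpos).ne' (hq j).ne', Real.log_mul hμ.ne' hpos.ne'] at this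
    linarith
  have hsum : ∑ j, Complex.normSq (W j i) * (Real.log (p i) + Real.log μ - Real.log (q j))
      ≤ ∑ j, Complex.normSq (W j i) * (μ * p i / q j - 1) :=
    Finset.sum_le_sum fun j _ => mul_le_mul_of_nonneg_left (hlog j) (Complex.normSq_nonneg _)
  have hr : ∑ j, Complex.normSq (W j i) * (μ * p i / q j - 1) = μ * p i * s - 1 := by
    simp only [mul_sub, Finset.sum_sub_distrib, mul_one, hcol, hs, Finset.mul_sum]
    congr 1
    exact Finset.sum_congr rfl fun j _ => by ring
  rw [hr] at hsum
  simp only [mul_sub, Finset.sum_sub_distrib, ← Finset.sum_mul, hcol, one_mul] at hsum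
  rw [one_div, Real.log_inv]
  linarith

theorem aux_spec {d : ℕ} {A : Matrix (Fin d) (Fin d) ℂ} (h : A.IsHermitian) :
    A = (h.eigenvectorUnitary : Matrix (Fin d) (Fin d) ℂ) *
      Matrix.diagonal (fun i => (h.eigenvalues i : ℂ)) *
      star (h.eigenvectorUnitary : Matrix (Fin d) (Fin d) ℂ) := by
  have := h.spectral_theorem
  rw [Unitary.conjStarAlgAut_apply] at this
  exact this

/-- **Operator dominance bounds the relative entropy:** if `ρ, σ` are density matrices,
`σ` positive definite, `μ > 0` and `σ − μρ` is positive semidefinite, then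
`S(ρ‖σ) ≤ log(1/μ)` (the inequality is in the complex order, so in particular
the relative entropy is real). -/
theorem stmt10 {d : ℕ}
    (ρ σ : Matrix (Fin d) (Fin d) ℂ)
    (hρ : ρ.PosSemidef) (hρtr : ρ.trace = 1)
    (hσ : σ.PosDef) (hσtr : σ.trace = 1)
    (μ : ℝ) (hμ : 0 < μ)
    (hdom : (σ - (μ : ℂ) • ρ).PosSemidef) :
    relEnt ρ σ ≤ (Real.log (1 / μ) : ℂ) := by
  have hr := hρ.isHermitian
  have ht := hσ.isHermitian
  have er := aux_spec hr
  have et := aux_spec ht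
  have hp : ∀ i, 0 ≤ hr.eigenvalues i := hρ.eigenvalues_nonneg
  have hq : ∀ i, 0 < ht.eigenvalues i := hσ.eigenvalues_pos
  unfold relEnt matLog
  rw [dif_pos hr, dif_pos ht]
  have hU1 : star (hr.eigenvectorUnitary : Matrix (Fin d) (Fin d) ℂ) *
    (hr.eigenvectorUnitary : Matrix (Fin d) (Fin d) ℂ) = 1 := Unitary.coe_star_mul_self _
  have hV1 : star (ht.eigenvectorUnitary : Matrix (Fin d) (Fin d) ℂ) *
    (ht.eigenvectorUnitary : Matrix (Fin d) (Fin d) ℂ) = 1 := Unitary.coe_star_mul_self _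
  have hV2 : (ht.eigenvectorUnitary : Matrix (Fin d) (Fin d) ℂ) *
    star (ht.eigenvectorUnitary : Matrix (Fin d) (Fin d) ℂ) = 1 := Unitary.coe_mul_star_self _
  generalize (hr.eigenvectorUnitary : Matrix (Fin d) (Fin d) ℂ) = U at *
  generalize (ht.eigenvectorUnitary : Matrix (Fin d) (Fin d) ℂ) = V at *
  generalize hr.eigenvalues = p at *
  generalize ht.eigenvalues = q at *
  clear hr ht hρ hσ
  have hW : star (star V * U) * (star V * U) = 1 := by
    rw [star_mul, star_star, Matrix.mul_assoc, ← Matrix.mul_assoc V, hV2, Matrix.one_mul, hU1]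
  have hdom' : (Matrix.diagonal (fun i => (q i : ℂ)) -
      (μ : ℂ) • ((star V * U) * Matrix.diagonal (fun i => (p i : ℂ)) *
        star (star V * U))).PosSemidef := by
    have h := hdom.conjTranspose_mul_mul_same V
    convert h using 1
    rw [← Matrix.star_eq_conjTranspose, Matrix.mul_sub, Matrix.sub_mul, Matrix.mul_smul,
      Matrix.smul_mul]
    congr 1
    · rw [et]
      simp only [← Matrix.mul_assoc, hV1, Matrix.one_mul]
      rw [Matrix.mul_assoc, hV1, Matrix.mul_one]
    · rw [er]
      simp only [star_mul, star_star, ← Matrix.mul_assoc]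
  have hterm := aux_term (star V * U) hW p q hp hq μ hμ hdom'
  have hptr : ∑ i, p i = 1 := by
    rw [er, Matrix.mul_assoc, Matrix.trace_mul_comm, Matrix.mul_assoc, hU1, Matrix.mul_one,
      Matrix.trace_diagonal] at hρtr
    exact_mod_cast hρtr
  have htr1 : (ρ * (U * Matrix.diagonal (fun i => (Real.log (p i) : ℂ)) * star U)).trace
      = ((∑ i, p i * Real.log (p i) : ℝ) : ℂ) := by
    have : ρ * (U * Matrix.diagonal (fun i => (Real.log (p i) : ℂ)) * star U) =
      U * (Matrix.diagonal (fun i => (p i : ℂ)) * (star U * U) *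
        Matrix.diagonal (fun i => (Real.log (p i) : ℂ)) * star U) := by
      rw [er]; simp only [Matrix.mul_assoc]
    rw [this, Matrix.trace_mul_comm, hU1, Matrix.mul_one, Matrix.mul_assoc, hU1, Matrix.mul_one,
      Matrix.diagonal_mul_diagonal, Matrix.trace_diagonal]
    push_cast
    rfl
  have htr2 : (ρ * (V * Matrix.diagonal (fun i => (Real.log (q i) : ℂ)) * star V)).trace
      = ((∑ i, p i * ∑ j, Complex.normSq ((star V * U) j i) * Real.log (q j) : ℝ) : ℂ) := by
    have : ρ * (V * Matrix.diagonal (fun i => (Real.log (q i) : ℂ)) * star V) =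
      U * (Matrix.diagonal (fun i => (p i : ℂ)) * (star (star V * U) *
        Matrix.diagonal (fun i => (Real.log (q i) : ℂ)) * star V)) := by
      rw [er]; simp only [star_mul, star_star, Matrix.mul_assoc]
    rw [this, Matrix.trace_mul_comm, Matrix.mul_assoc, Matrix.mul_assoc _ (star V) U]
    generalize star V * U = W
    simp only [Matrix.trace, Matrix.diag_apply, Matrix.diagonal_mul]
    push_cast
    refine Finset.sum_congr rfl fun i _ => ?_
    congr 1
    rw [Matrix.mul_apply]
    refine Finset.sum_congr rfl fun j _ => ?_
    rw [Matrix.mul_diagonal, Matrix.star_apply, Complex.normSq_eq_conj_mul_self, Complex.star_def]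
    ring
  rw [Matrix.mul_sub, Matrix.trace_sub, htr1, htr2]
  have hfin := Finset.sum_le_sum fun i (_ : i ∈ Finset.univ) => hterm i
  simp only [mul_sub, Finset.sum_sub_distrib] at hfin
  rw [← Finset.sum_mul, hptr, one_mul] at hfin
  exact_mod_cast hfin
end

section
/- (Existence and index-preservation of the dual conditional expectation, combinatorial form.) Let J and K be nonempty finite index sets, let μ : K × J → ℕ with μ(k,j) ≥ 1, and for each (k,j) let t_{l,jk} > 0 (l = 1,…,μ(k,j)) with Σ_l t_{l,jk} = 1, and let p_{kj} > 0 with Σ_{j∈J} p_{kj} = 1 for each k ∈ K. Set λ_{jk} := Σ_l 1/t_{l,jk} and λ_j := Σ_{k∈K} λ_{jk}/p_{kj}, and assume λ_j = λ is independent of j ∈ J. Define p̃_{jk} := λ⁻¹ λ_{jk}/p_{kj} and t̃_{l,jk} := λ⁻¹ / (p_{kj} p̃_{jk} t_{l,jk}). Then: (i) Σ_{k∈K} p̃_{jk} = 1 for every j; (ii) t̃_{l,jk} > 0 and Σ_l t̃_{l,jk} = 1 for every (k,j); (iii) p_{kj} · p̃_{jk} · t_{l,jk} · t̃_{l,jk}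 = 1/λ for all l, j, k; (iv) for every k ∈ K, Σ_{j∈J} (Σ_l 1/t̃_{l,jk}) / p̃_{jk} = λ. -/
/-- **Existence and index-preservation of the dual conditional expectation
(combinatorial form).** Given the data `μ`, `t`, `p` parametrizing a conditional
expectation with `j`-independent index `λ`, the dual data `p̃`, `t̃` defined by
`p̃_{jk} = λ⁻¹ λ_{jk} / p_{kj}` and `t̃_{l,jk} = λ⁻¹ / (p_{kj} p̃_{jk} t_{l,jk})`
are again probability data, satisfy the certainty relation
`p_{kj} p̃_{jk} t_{l,jk} t̃_{l,jk} = 1/λ`, and have the same index `λ`. -/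
theorem stmt11 {J K : Type*} [Fintype J] [Fintype K] [Nonempty J] [Nonempty K]
    (μ : K → J → ℕ) (hμ : ∀ k j, 1 ≤ μ k j)
    (t : (k : K) → (j : J) → Fin (μ k j) → ℝ)
    (ht : ∀ k j l, 0 < t k j l)
    (htsum : ∀ k j, ∑ l, t k j l = 1)
    (p : K → J → ℝ)
    (hp : ∀ k j, 0 < p k j)
    (hpsum : ∀ k, ∑ j, p k j = 1)
    (lam : ℝ)
    (hlam : ∀ j, ∑ k, (∑ l, (t k j l)⁻¹) / p k j = lam)
    (pt : J → K → ℝ)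
    (hpt : ∀ j k, pt j k = lam⁻¹ * ((∑ l, (t k j l)⁻¹) / p k j))
    (tt : (k : K) → (j : J) → Fin (μ k j) → ℝ)
    (htt : ∀ k j l, tt k j l = lam⁻¹ / (p k j * pt j k * t k j l)) :
    -- (i) the p̃'s are probabilities
    (∀ j, ∑ k, pt j k = 1) ∧
    -- (ii) the t̃'s are probabilities
    (∀ k j l, 0 < tt k j l) ∧
    (∀ k j, ∑ l, tt k j l = 1) ∧
    -- (iii) the certainty relation
    (∀ k j l, p k j * pt j k * t k j l * tt k j l = 1 / lam) ∧
    -- (iv) the dual data has the same index λ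
    (∀ k, ∑ j, (∑ l, (tt k j l)⁻¹) / pt j k = lam) := by

  have hS : ∀ k j, 0 < ∑ l, (t k j l)⁻¹ := by
    intro k j
    have : Nonempty (Fin (μ k j)) := ⟨⟨0, hμ k j⟩⟩
    exact Finset.sum_pos (fun l _ => inv_pos.mpr (ht k j l)) Finset.univ_nonempty
  have hl : 0 < lam := by
    rw [← hlam (Classical.arbitrary J)]
    exact Finset.sum_pos (fun k _ => div_pos (hS k _) (hp k _)) Finset.univ_nonempty
  have hptpos : ∀ j k, 0 < pt j k := by
    intro j k
    rw [hpt]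
    exact mul_pos (inv_pos.mpr hl) (div_pos (hS k j) (hp k j))
  have hprod : ∀ k j, p k j * pt j k = lam⁻¹ * ∑ l, (t k j l)⁻¹ := by
    intro k j
    have := (hp k j).ne'
    rw [hpt]
    field_simp
  refine ⟨?_, ?_, ?_, ?_, ?_⟩
  · intro j
    simp_rw [hpt]
    rw [← Finset.mul_sum, hlam, inv_mul_cancel₀ hl.ne']
  · intro k j l
    rw [htt]
    exact div_pos (inv_pos.mpr hl) (mul_pos (mul_pos (hp k j) (hptpos j k)) (ht k j l))
  · intro k j
    have h : ∀ l, tt k j l = lam⁻¹ / (p k j * pt j k) * (t k j l)⁻¹ := by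
      intro l
      rw [htt, ← div_div, div_eq_mul_inv _ (t k j l)]
    simp_rw [h]
    rw [← Finset.mul_sum, div_mul_eq_mul_div, ← hprod]
    exact div_self (mul_pos (hp k j) (hptpos j k)).ne'
  · intro k j l
    rw [htt, mul_div_cancel₀, one_div]
    exact (mul_pos (mul_pos (hp k j) (hptpos j k)) (ht k j l)).ne'
  · intro k
    have h : ∀ j, (∑ l, (tt k j l)⁻¹) / pt j k = lam * p k j := by
      intro j
      have h1 : ∀ l, (tt k j l)⁻¹ = lam * (p k j * pt j k) * t k j l := by
        intro l
        rw [htt, inv_div, div_inv_eq_mul]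
        ring
      simp_rw [h1]
      rw [← Finset.mul_sum, htsum]
      have := (hptpos j k).ne'
      field_simp
    simp_rw [h]
    rw [← Finset.mul_sum, hpsum, mul_one]
end
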